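/- arXiv:math/0211204 — 2 statements merged into one kernel-verified Lean document; each statement's English description precedes it below -/
import Mathlib

section
/- Let G be a countably infinite abelian group such that the dilation 2∗G = {g + g : g ∈ G} is infinite. Let f : G → ℕ₀ ∪ {∞} be any map such that the set Z₀ = f⁻¹(0) is a finite subset of G. Then there exists a set B ⊆ G such that r̂_B(x) = f(x) for all x ∈ G; in particular B is a restricted asymptotic basis of order 2 for G. -/
/-- The restricted representation function of a subset `B` of an additive
semigroup: `restrictedRep B x` counts the number of sets `{b, b'} ⊆ B`
with `b ≠ b'` and `b + b' = x`. -/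
noncomputable def restrictedRep {X : Type*} [Add X] (B : Set X) (x : X) : ℕ∞ :=
  {s : Set X | ∃ b ∈ B, ∃ b' ∈ B, b ≠ b' ∧ b + b' = x ∧ s = {b, b'}}.encard

/-- The pairs of distinct elements of `B` with sum `x`; `restrictedRep B x` is their number. -/
def repPairs {X : Type*} [Add X] (B : Set X) (x : X) : Set (Set X) :=
  {s : Set X | ∃ b ∈ B, ∃ b' ∈ B, b ≠ b' ∧ b + b' = x ∧ s = {b, b'}}

theorem restrictedRep_eq_encard_repPairs {X : Type*} [Add X] (B : Set X) (x : X) :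
    restrictedRep B x = (repPairs B x).encard := rfl

theorem repPairs_mono {X : Type*} [Add X] {B C : Set X} (h : B ⊆ C) (x : X) :
    repPairs B x ⊆ repPairs C x := by
  rintro s ⟨b, hb, b', hb', hs⟩
  exact ⟨b, h hb, b', h hb', hs⟩

theorem restrictedRep_mono {X : Type*} [Add X] {B C : Set X} (h : B ⊆ C) (x : X) :
    restrictedRep B x ≤ restrictedRep C x :=
  Set.encard_le_encard (repPairs_mono h x)

/-- If `2 ∗ G` is infinite, there is a pair with prescribed sum `u` that is in general position
with respect to finite sets `B` and `S`. -/
theorem exists_add_eq_generic {G : Type*} [AddCommGroup G]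
    (hG : (Set.range fun g : G => g + g).Infinite) {B S : Set G} (hB : B.Finite)
    (hS : S.Finite) (u : G) :
    ∃ a c : G, a + c = u ∧ a ≠ c ∧ (∀ b ∈ B, ∀ b' ∈ B, b + a ≠ b' + c) ∧
      ∀ b ∈ B, ∀ s ∈ S, b + a ≠ s ∧ b + c ≠ s := by
  let F : Filter G := Filter.comap (fun g : G => g + g) Filter.cofinite
  have hF : F.NeBot := by
    rw [Filter.comap_neBot_iff_frequently, Filter.frequently_cofinite_iff_infinite]
    exact hG
  have double_ne : ∀ t : G, ∀ᶠ a in F, a + a ≠ t := fun t =>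
    Filter.Eventually.comap (Filter.eventually_cofinite_ne t) _
  have ne : ∀ t : G, ∀ᶠ a in F, a ≠ t := fun t =>
    (double_ne (t + t)).mono fun a ha h => ha (by rw [h])
  have h₁ : ∀ᶠ a in F, ∀ b ∈ B, ∀ b' ∈ B, a + a ≠ b' - b + u :=
    (Filter.eventually_all_finite hB).2 fun b _ =>
      (Filter.eventually_all_finite hB).2 fun b' _ => double_ne _
  have h₂ : ∀ᶠ a in F, ∀ b ∈ B, ∀ s ∈ S, a ≠ s - b ∧ a ≠ b + u - s :=
    (Filter.eventually_all_finite hB).2 fun b _ =>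
      (Filter.eventually_all_finite hS).2 fun s _ => (ne _).and (ne _)
  obtain ⟨a, ha, ha₁, ha₂⟩ := ((double_ne u).and (h₁.and h₂)).exists
  refine ⟨a, u - a, by abel, fun h => ha ?_, fun b hb b' hb' h => ha₁ b hb b' hb' ?_,
    fun b hb s hs => ⟨fun h => (ha₂ b hb s hs).1 ?_, fun h => (ha₂ b hb s hs).2 ?_⟩⟩
  · exact eq_sub_iff_add_eq.1 h
  · calc a + a = b + a - b + a := by abel
      _ = b' - b + u := by rw [h]; abel
  · rw [← h]; abel
  · rw [← h]; abel

/-- Adjoining a pair in general position with sum `u` creates exactly one new representation of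
`u`, and otherwise only unique representations of elements outside `f ⁻¹' {0}`. -/
theorem exists_finite_superset_restrictedRep_le {G : Type*} [AddCommGroup G]
    (hG : (Set.range fun g : G => g + g).Infinite) {f : G → ℕ∞} (hf : (f ⁻¹' {0}).Finite)
    {B : Set G} (hB : B.Finite) (hBf : ∀ x, restrictedRep B x ≤ f x) {u : G}
    (hu : restrictedRep B u < f u) :
    ∃ C : Set G, B ⊆ C ∧ C.Finite ∧ (∀ x, restrictedRep C x ≤ f x) ∧
      restrictedRep B u + 1 ≤ restrictedRep C u := by
  have hS : (f ⁻¹' {0} ∪ {u} ∪ Set.image2 (· + ·) B B).Finite :=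
    (hf.union (Set.finite_singleton u)).union (hB.image2 _ hB)
  obtain ⟨a, c, hac, hne, hcross, hout⟩ := exists_add_eq_generic hG hB hS u
  have hzero : ∀ b ∈ B, f (b + a) ≠ 0 ∧ f (b + c) ≠ 0 := fun b hb =>
    ⟨fun h => (hout b hb (b + a) (.inl (.inl h))).1 rfl,
      fun h => (hout b hb (b + c) (.inl (.inl h))).2 rfl⟩
  have hnu : ∀ b ∈ B, b + a ≠ u ∧ b + c ≠ u := fun b hb => hout b hb u (.inl (.inr rfl))
  have hsum : ∀ b ∈ B, ∀ d ∈ B, ∀ d' ∈ B, b + a ≠ d + d' ∧ b + c ≠ d + d' :=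
    fun b hb d hd d' hd' => hout b hb _ (.inr ⟨d, hd, d', hd', rfl⟩)
  have haB : a ∉ B := fun h => (hsum a h a h a h).1 rfl
  have hcases : ∀ x, ∀ s ∈ repPairs (B ∪ {a, c}) x, s ∈ repPairs B x ∨
      (x = u ∧ s = {a, c}) ∨ (∃ b ∈ B, x = b + a ∧ s = {b, a}) ∨
      ∃ b ∈ B, x = b + c ∧ s = {b, c} := by
    rintro x s ⟨b, hb, b', hb', hbb, rfl, rfl⟩
    rcases hb with hb | rfl | rfl <;> rcases hb' with hb' | rfl | rfl
    · exact .inl ⟨b, hb, b', hb', hbb, rfl, rfl⟩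
    · exact .inr (.inr (.inl ⟨b, hb, rfl, rfl⟩))
    · exact .inr (.inr (.inr ⟨b, hb, rfl, rfl⟩))
    · exact .inr (.inr (.inl ⟨b', hb', add_comm _ _, Set.pair_comm _ _⟩))
    · exact absurd rfl hbb
    · exact .inr (.inl ⟨hac, rfl⟩)
    · exact .inr (.inr (.inr ⟨b', hb', add_comm _ _, Set.pair_comm _ _⟩))
    · exact .inr (.inl ⟨by rw [add_comm, hac], Set.pair_comm _ _⟩)
    · exact absurd rfl hbb
  refine ⟨B ∪ {a, c}, Set.subset_union_left, hB.union (Set.toFinite _), fun x => ?_, ?_⟩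
  · by_cases hxu : x = u
    · subst hxu
      refine le_trans ?_ (Order.add_one_le_of_lt hu)
      refine le_trans (Set.encard_le_encard ?_) (Set.encard_insert_le (repPairs B x) {a, c})
      intro s hs
      rcases hcases x s hs with h | ⟨-, h⟩ | ⟨b, hb, h, -⟩ | ⟨b, hb, h, -⟩
      · exact .inr h
      · exact .inl h
      · exact absurd h.symm (hnu b hb).1
      · exact absurd h.symm (hnu b hb).2
    · have single : f x ≠ 0 → ∀ t, (∀ s ∈ repPairs (B ∪ {a, c}) x, s = t) →
          restrictedRep (B ∪ {a, c}) x ≤ f x := fun h0 t ht =>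
        ((Set.encard_le_encard (t := {t}) ht).trans_eq (Set.encard_singleton t)).trans
          (Order.one_le_iff_ne_zero.2 h0)
      by_cases hxa : ∃ b ∈ B, x = b + a
      · obtain ⟨b, hb, rfl⟩ := hxa
        refine single (hzero b hb).1 {b, a} fun s hs => ?_
        rcases hcases _ s hs with ⟨d, hd, d', hd', -, h, -⟩ | ⟨h, -⟩ | ⟨d, hd, h, hs⟩ |
          ⟨d, hd, h, -⟩
        · exact absurd h.symm (hsum b hb d hd d' hd').1
        · exact absurd h hxu
        · rw [hs, add_right_cancel h]
        · exact absurd h (hcross b hb d hd)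
      by_cases hxc : ∃ b ∈ B, x = b + c
      · obtain ⟨b, hb, rfl⟩ := hxc
        refine single (hzero b hb).2 {b, c} fun s hs => ?_
        rcases hcases _ s hs with ⟨d, hd, d', hd', -, h, -⟩ | ⟨h, -⟩ | ⟨d, hd, h, -⟩ |
          ⟨d, hd, h, hs⟩
        · exact absurd h.symm (hsum b hb d hd d' hd').2
        · exact absurd h hxu
        · exact absurd h.symm (hcross d hd b hb)
        · rw [hs, add_right_cancel h]
      refine (Set.encard_le_encard fun s hs => ?_).trans (hBf x)
      rcases hcases x s hs with h | ⟨h, -⟩ | ⟨b, hb, h, -⟩ | ⟨b, hb, h, -⟩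
      · exact h
      · exact absurd h hxu
      · exact absurd ⟨b, hb, h⟩ hxa
      · exact absurd ⟨b, hb, h⟩ hxc
  · have hnot : ({a, c} : Set G) ∉ repPairs B u := by
      rintro ⟨b, hb, b', hb', -, -, h⟩
      have : a ∈ ({b, b'} : Set G) := h ▸ Set.mem_insert a {c}
      rcases this with rfl | rfl <;> exact haB ‹_›
    rw [restrictedRep_eq_encard_repPairs, ← Set.encard_insert_of_notMem hnot]
    exact Set.encard_le_encard <| Set.insert_subset
      ⟨a, by simp, c, by simp, hne, hac, rfl⟩ (repPairs_mono Set.subset_union_left u)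

/-- A bound on the representation functions of an increasing sequence of sets passes to the
union. -/
theorem restrictedRep_iUnion_le {X : Type*} [Add X] {B : ℕ → Set X} (hB : Monotone B) {x : X}
    {n : ℕ∞} (h : ∀ k, restrictedRep (B k) x ≤ n) : restrictedRep (⋃ k, B k) x ≤ n := by
  by_contra! hlt
  obtain ⟨t, ht, htcard⟩ := Set.exists_subset_encard_eq (Order.add_one_le_of_lt hlt)
  have hn : n ≠ ⊤ := hlt.ne_top
  have htfin : t.Finite := by
    rw [← Set.encard_ne_top_iff, htcard]
    simpa using hn
  have hev : ∀ᶠ k in Filter.atTop, ∀ s ∈ t, s ∈ repPairs (B k) x := by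
    refine (Filter.eventually_all_finite htfin).2 fun s hs => ?_
    obtain ⟨b, hb, b', hb', hs⟩ := ht hs
    obtain ⟨i, hi⟩ := Set.mem_iUnion.1 hb
    obtain ⟨j, hj⟩ := Set.mem_iUnion.1 hb'
    filter_upwards [Filter.eventually_ge_atTop i, Filter.eventually_ge_atTop j] with k hik hjk
    exact ⟨b, hB hik hi, b', hB hjk hj, hs⟩
  obtain ⟨k, hk⟩ := hev.exists
  have hle : n + 1 ≤ n := htcard ▸ (Set.encard_le_encard hk).trans (h k)
  exact ((ENat.add_one_le_iff hn).1 hle).false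

theorem stmt1 {G : Type*} [AddCommGroup G] [Countable G] [Infinite G]
    (hG : (Set.range fun g : G => g + g).Infinite)
    (f : G → ℕ∞) (hf : (f ⁻¹' {0}).Finite) :
    ∃ B : Set G, (∀ x : G, restrictedRep B x = f x) ∧
      {x : G | ¬ 1 ≤ restrictedRep B x}.Finite := by
  suffices ∃ B : Set G, ∀ x : G, restrictedRep B x = f x by
    obtain ⟨B, hB⟩ := this
    refine ⟨B, hB, hf.subset fun x hx => ?_⟩
    simpa [hB, Order.one_le_iff_ne_zero] using hx
  obtain ⟨g, hg⟩ := exists_surjective_nat G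
  let T := {B : Set G // B.Finite ∧ ∀ x, restrictedRep B x ≤ f x}
  have step : ∀ (B : T) (u : G), ∃ C : T, B.1 ⊆ C.1 ∧
      (restrictedRep B.1 u < f u → restrictedRep B.1 u + 1 ≤ restrictedRep C.1 u) := by
    rintro ⟨B, hB, hBf⟩ u
    by_cases hu : restrictedRep B u < f u
    · obtain ⟨C, hBC, hC, hCf, hCu⟩ := exists_finite_superset_restrictedRep_le hG hf hB hBf hu
      exact ⟨⟨C, hC, hCf⟩, hBC, fun _ => hCu⟩
    · exact ⟨⟨B, hB, hBf⟩, subset_rfl, fun h => absurd h hu⟩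
  choose next hsub hnext using step
  have hempty : ∀ x, restrictedRep (∅ : Set G) x ≤ f x := fun x => by simp [restrictedRep]
  let B : ℕ → T := fun k => Nat.rec ⟨∅, Set.finite_empty, hempty⟩
    (fun k C => next C (g k.unpair.1)) k
  have hmono : Monotone fun k => (B k).1 := monotone_nat_of_le_succ fun k => hsub _ _
  have hreach : ∀ (x : G) (n : ℕ), (n : ℕ∞) ≤ f x → ∃ k, (n : ℕ∞) ≤ restrictedRep (B k).1 x := by
    intro x n
    induction n with
    | zero => exact fun _ => ⟨0, by simp⟩
    | succ n ih =>
      intro hn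
      push_cast at hn ⊢
      obtain ⟨N, hN⟩ := ih (le_self_add.trans hn)
      obtain ⟨m, rfl⟩ := hg x
      let k := Nat.pair m N
      have hk : (n : ℕ∞) ≤ restrictedRep (B k).1 (g m) :=
        hN.trans (restrictedRep_mono (hmono (Nat.right_le_pair m N)) _)
      by_cases hlt : restrictedRep (B k).1 (g m) < f (g m)
      · refine ⟨k + 1, (add_le_add_left hk 1).trans ?_⟩
        have hBk : B (k + 1) = next (B k) (g m) := by
          change next (B k) (g k.unpair.1) = _
          simp [k]
        rw [hBk]
        exact hnext (B k) (g m) hlt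
      · exact ⟨k, hn.trans (not_lt.1 hlt)⟩
  refine ⟨⋃ k, (B k).1, fun x => le_antisymm ?_ ?_⟩
  · exact restrictedRep_iUnion_le hmono fun k => (B k).2.2 x
  · refine ENat.forall_natCast_le_iff_le.1 fun n hn => ?_
    obtain ⟨k, hk⟩ := hreach x n hn
    exact hk.trans (restrictedRep_mono (Set.subset_iUnion (fun k => (B k).1) k) x)
end

section
/- Let G be a countably infinite abelian group such that the dilation 12∗G = {12g : g ∈ G} is infinite. Let f : G → ℕ₀ ∪ {∞} be any map such that the set Z₀ = f⁻¹(0) is finite. Then there exists a set B ⊆ G such that r_B(x) = f(x) for all x ∈ G; in particular B is an asymptotic basis of order 2 for G. -/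
/-- The (unrestricted) representation function of a subset `B` of an additive
semigroup: `rep B x` counts the number of sets `{b, b'} ⊆ B` (with `b = b'`
allowed) such that `b + b' = x`. -/
noncomputable def rep {X : Type*} [Add X] (B : Set X) (x : X) : ℕ∞ :=
  {s : Set X | ∃ b ∈ B, ∃ b' ∈ B, b + b' = x ∧ s = {b, b'}}.encard

/-- The set of pairs counted by `rep B x`. -/
def pairs {X : Type*} [Add X] (B : Set X) (x : X) : Set (Set X) :=
  {s : Set X | ∃ b ∈ B, ∃ b' ∈ B, b + b' = x ∧ s = {b, b'}}

theorem rep_eq_encard_pairs {X : Type*} [Add X] (B : Set X) (x : X) :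
    rep B x = (pairs B x).encard := rfl

theorem pairs_mono {X : Type*} [Add X] {B C : Set X} (h : B ⊆ C) (x : X) :
    pairs B x ⊆ pairs C x := by
  rintro s ⟨b, hb, b', hb', hx, hs⟩
  exact ⟨b, h hb, b', h hb', hx, hs⟩

theorem rep_mono {X : Type*} [Add X] {B C : Set X} (h : B ⊆ C) (x : X) :
    rep B x ≤ rep C x :=
  Set.encard_le_encard (pairs_mono h x)

theorem subset_of_mem_pairs {X : Type*} [Add X] {B s : Set X} {x : X}
    (h : s ∈ pairs B x) : s ⊆ B := by
  obtain ⟨b, hb, b', hb', -, rfl⟩ := h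
  rintro y (rfl | rfl) <;> assumption

theorem finite_of_mem_pairs {X : Type*} [Add X] {B s : Set X} {x : X}
    (h : s ∈ pairs B x) : s.Finite := by
  obtain ⟨b, hb, b', hb', -, rfl⟩ := h
  exact Set.toFinite _

theorem mem_pairs_of_subset {X : Type*} [Add X] {B C s : Set X} {x : X}
    (h : s ∈ pairs B x) (hs : s ⊆ C) : s ∈ pairs C x := by
  obtain ⟨b, hb, b', hb', hx, rfl⟩ := h
  exact ⟨b, hs (by simp), b', hs (by simp), hx, rfl⟩

/-- A bound on representation functions passes to directed unions. -/
theorem rep_sUnion_le {X : Type*} [Add X] {𝓑 : Set (Set X)} (hne : 𝓑.Nonempty)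
    (hdir : DirectedOn (· ⊆ ·) 𝓑) {x : X} {m : ℕ∞} (h : ∀ B ∈ 𝓑, rep B x ≤ m) :
    rep (⋃₀ 𝓑) x ≤ m := by
  by_contra! hlt
  have hm : m ≠ ⊤ := hlt.ne_top
  obtain ⟨t, ht, htc⟩ := Set.exists_subset_encard_eq (Order.add_one_le_of_lt hlt)
  have htfin : t.Finite := Set.finite_of_encard_le_coe (k := (m + 1).toNat) (by
    rw [htc, ENat.natCast_toNat]
    simpa using hm)
  have hUfin : (⋃₀ t).Finite := htfin.sUnion fun s hs => finite_of_mem_pairs (ht hs)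
  have hU : ⋃₀ t ⊆ ⋃₀ 𝓑 := Set.sUnion_subset fun s hs => subset_of_mem_pairs (ht hs)
  obtain ⟨B, hB, hUB⟩ := hdir.exists_mem_subset_of_finite_of_subset_sUnion hne hUfin hU
  have hle : m + 1 ≤ rep B x := by
    rw [← htc]
    exact Set.encard_le_encard fun s hs =>
      mem_pairs_of_subset (ht hs) ((Set.subset_sUnion_of_mem hs).trans hUB)
  have := hle.trans (h B hB)
  exact absurd this (not_le.2 ((ENat.lt_add_one_iff hm).2 le_rfl))

/-- If `12 ∗ G` is infinite, some `a` avoids finitely many equations `k • a = c` with `k ∣ 12`. -/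
theorem exists_nsmul_notMem {G : Type*} [AddCommGroup G]
    (hG : (Set.range fun g : G => (12 : ℕ) • g).Infinite) {C : Set G} (hC : C.Finite) :
    ∃ a : G, ∀ k : ℕ, k ∣ 12 → k • a ∉ C := by
  have hfin : (⋃ k ∈ Finset.range 13, (fun c : G => k • c) '' C).Finite :=
    (Finset.range 13).finite_toSet.biUnion fun k _ => hC.image _
  obtain ⟨_, ⟨a, rfl⟩, ha⟩ := hG.exists_notMem_finite hfin
  refine ⟨a, fun k hk hmem => ha ?_⟩
  obtain ⟨l, hl⟩ := hk
  refine Set.mem_biUnion (x := l) ?_ ⟨k • a, hmem, ?_⟩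
  · have : l ≤ 12 := Nat.le_of_dvd (by norm_num) ⟨k, by rw [hl, mul_comm]⟩
    simpa using Nat.lt_succ_of_le this
  · simp only [hl, mul_comm k l, mul_smul]

/-- A finite set with `r_B ≤ f` and `r_B(u) < f(u)` can be enlarged so that `r_B(u)` grows by one
while the bound is kept. -/
theorem exists_superset_rep_eq_add_one {G : Type*} [AddCommGroup G]
    (hG : (Set.range fun g : G => (12 : ℕ) • g).Infinite)
    {f : G → ℕ∞} (hf : (f ⁻¹' {0}).Finite) {B : Set G} (hB : B.Finite)
    (hBf : ∀ x, rep B x ≤ f x) {u : G} (hu : rep B u < f u) :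
    ∃ C, B ⊆ C ∧ C.Finite ∧ (∀ x, rep C x ≤ f x) ∧ rep C u = rep B u + 1 := by
  classical
  let Y : Set G := insert u (f ⁻¹' {0} ∪ Set.image2 (· + ·) B B)
  have hY : Y.Finite := (hf.union (hB.image2 _ hB)).insert u
  let D : Set G := insert 0 (B ∪ Y)
  have hD : D.Finite := (hB.union hY).insert 0
  obtain ⟨a, ha⟩ := exists_nsmul_notMem hG ((hD.image2 (· + ·) hD).image2 (· - ·) hD)
  have avoid : ∀ k : ℕ, k ∣ 12 → ∀ p ∈ D, ∀ q ∈ D, ∀ r ∈ D, k • a ≠ p + q - r :=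
    fun k hk p hp q hq r hr h => ha k hk ⟨_, ⟨p, hp, q, hq, rfl⟩, r, hr, h.symm⟩
  have h0 : (0 : G) ∈ D := Set.mem_insert _ _
  have hBD : ∀ c ∈ B, c ∈ D := fun c hc => Or.inr (Or.inl hc)
  have hYD : ∀ y ∈ Y, y ∈ D := fun y hy => Or.inr (Or.inr hy)
  have huD : u ∈ D := hYD u (Set.mem_insert _ _)
  have hsum : ∀ c ∈ B, ∀ d ∈ B, c + d ∈ Y := fun c hc d hd => Or.inr (Or.inr ⟨c, hc, d, hd, rfl⟩)
  obtain ⟨b, hb⟩ : ∃ b, b = u - a := ⟨_, rfl⟩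
  have hab : a + b = u := by rw [hb]; abel
  have haB : ∀ c ∈ B, a ≠ c := fun c hc h =>
    avoid 1 (by norm_num) c (hBD c hc) 0 h0 0 h0 (by subst h; simp)
  have hbB : ∀ c ∈ B, b ≠ c := fun c hc h =>
    avoid 1 (by norm_num) u huD 0 h0 c (hBD c hc) (by rw [← h, hb]; abel)
  have haa : a + a ∉ Y := fun h =>
    avoid 2 (by norm_num) _ (hYD _ h) 0 h0 0 h0 (by abel)
  have hbb : b + b ∉ Y := fun h =>
    avoid 2 (by norm_num) u huD u huD _ (hYD _ h) (by rw [hb]; abel)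
  have hac : ∀ c ∈ B, a + c ∉ Y := fun c hc h =>
    avoid 1 (by norm_num) _ (hYD _ h) 0 h0 c (hBD c hc) (by abel)
  have hbc : ∀ c ∈ B, b + c ∉ Y := fun c hc h =>
    avoid 1 (by norm_num) u huD c (hBD c hc) _ (hYD _ h) (by rw [hb]; abel)
  have haabb : a + a ≠ b + b := fun h =>
    avoid 4 (by norm_num) u huD u huD 0 h0 (by
      calc 4 • a = (a + a) + (a + a) := by abel
        _ = (a + a) + (b + b) := by rw [← h]
        _ = u + u - 0 := by rw [hb]; abel)
  have haabc : ∀ c ∈ B, a + a ≠ b + c := fun c hc h =>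
    avoid 3 (by norm_num) u huD c (hBD c hc) 0 h0 (by
      calc 3 • a = (a + a) + a := by abel
        _ = (b + c) + a := by rw [h]
        _ = u + c - 0 := by rw [hb]; abel)
  have hbbac : ∀ c ∈ B, b + b ≠ a + c := fun c hc h =>
    avoid 3 (by norm_num) u huD u huD c (hBD c hc) (by
      calc 3 • a = (a + c) + (a + a) - c := by abel
        _ = (b + b) + (a + a) - c := by rw [h]
        _ = u + u - c := by rw [hb]; abel)
  have hacbc : ∀ c ∈ B, ∀ d ∈ B, a + c ≠ b + d := fun c hc d hd h =>
    avoid 2 (by norm_num) u huD d (hBD d hd) c (hBD c hc) (by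
      calc 2 • a = (a + c) + a - c := by abel
        _ = (b + d) + a - c := by rw [h]
        _ = u + d - c := by rw [hb]; abel)
  let C : Set G := insert a (insert b B)
  have hBC : B ⊆ C := (Set.subset_insert _ _).trans (Set.subset_insert _ _)
  have hcases : ∀ x, ∀ s ∈ pairs C x, s ∈ pairs B x ∨ (x = u ∧ s = {a, b}) ∨
      x ∉ Y ∧ ((x = a + a ∧ s = {a, a}) ∨ (x = b + b ∧ s = {b, b}) ∨
        (∃ c ∈ B, x = a + c ∧ s = {a, c}) ∨ (∃ c ∈ B, x = b + c ∧ s = {b, c})) := by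
    rintro _ _ ⟨c, rfl | rfl | hc, d, rfl | rfl | hd, rfl, rfl⟩
    · exact Or.inr (Or.inr ⟨haa, Or.inl ⟨rfl, rfl⟩⟩)
    · exact Or.inr (Or.inl ⟨hab, rfl⟩)
    · exact Or.inr (Or.inr ⟨hac d hd, Or.inr (Or.inr (Or.inl ⟨d, hd, rfl, rfl⟩))⟩)
    · exact Or.inr (Or.inl ⟨by rw [add_comm, hab], Set.pair_comm _ _⟩)
    · exact Or.inr (Or.inr ⟨hbb, Or.inr (Or.inl ⟨rfl, rfl⟩)⟩)
    · exact Or.inr (Or.inr ⟨hbc d hd, Or.inr (Or.inr (Or.inr ⟨d, hd, rfl, rfl⟩))⟩)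
    · rw [add_comm, Set.pair_comm]
      exact Or.inr (Or.inr ⟨hac c hc, Or.inr (Or.inr (Or.inl ⟨c, hc, rfl, rfl⟩))⟩)
    · rw [add_comm, Set.pair_comm]
      exact Or.inr (Or.inr ⟨hbc c hc, Or.inr (Or.inr (Or.inr ⟨c, hc, rfl, rfl⟩))⟩)
    · exact Or.inl ⟨c, hc, d, hd, rfl, rfl⟩
  have hpu : pairs C u = insert {a, b} (pairs B u) := by
    ext s
    constructor
    · intro hs
      rcases hcases u s hs with h | h | h
      · exact Or.inr h
      · exact Or.inl h.2
      · exact absurd (Set.mem_insert _ _) h.1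
    · rintro (rfl | hs)
      · exact ⟨a, by simp [C], b, by simp [C], hab, rfl⟩
      · exact pairs_mono hBC u hs
  have hnew : ({a, b} : Set G) ∉ pairs B u := fun h =>
    haB a (subset_of_mem_pairs h (by simp)) rfl
  have hru : rep C u = rep B u + 1 := by
    rw [rep_eq_encard_pairs, hpu, Set.encard_insert_of_notMem hnew, rep_eq_encard_pairs]
  refine ⟨C, hBC, (hB.insert b).insert a, fun x => ?_, hru⟩
  by_cases hxu : x = u
  · rw [hxu, hru]
    exact Order.add_one_le_of_lt hu
  by_cases hxY : x ∈ Y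
  · refine (Set.encard_le_encard fun s hs => ?_).trans (hBf x)
    rcases hcases x s hs with h | h | h
    · exact h
    · exact absurd h.1 hxu
    · exact absurd hxY h.1
  · have hfx : 1 ≤ f x := Order.one_le_iff_pos.2
      (pos_iff_ne_zero.2 fun h => hxY (Or.inr (Or.inl h)))
    refine le_trans (Set.encard_le_one_iff.2 fun s t hs ht => ?_) hfx
    have key : ∀ s ∈ pairs C x, (x = a + a ∧ s = {a, a}) ∨ (x = b + b ∧ s = {b, b}) ∨
        (∃ c ∈ B, x = a + c ∧ s = {a, c}) ∨ (∃ c ∈ B, x = b + c ∧ s = {b, c}) := by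
      intro s hs
      rcases hcases x s hs with ⟨c, hc, d, hd, rfl, -⟩ | h | h
      · exact absurd (hsum c hc d hd) hxY
      · exact absurd h.1 hxu
      · exact h.2
    rcases key s hs with ⟨h, rfl⟩ | ⟨h, rfl⟩ | ⟨c, hc, h, rfl⟩ | ⟨c, hc, h, rfl⟩ <;>
    rcases key t ht with ⟨h', rfl⟩ | ⟨h', rfl⟩ | ⟨d, hd, h', rfl⟩ | ⟨d, hd, h', rfl⟩ <;>
    grind

/-- A finite set with `r_B ≤ f` can be enlarged, keeping the bound, until `r_B(u)` reaches any
prescribed level not exceeding `f(u)`. -/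
theorem exists_superset_min_le_rep {G : Type*} [AddCommGroup G]
    (hG : (Set.range fun g : G => (12 : ℕ) • g).Infinite)
    {f : G → ℕ∞} (hf : (f ⁻¹' {0}).Finite) {B : Set G} (hB : B.Finite)
    (hBf : ∀ x, rep B x ≤ f x) (u : G) (k : ℕ) :
    ∃ C, B ⊆ C ∧ C.Finite ∧ (∀ x, rep C x ≤ f x) ∧ min (f u) k ≤ rep C u := by
  induction k with
  | zero => exact ⟨B, subset_rfl, hB, hBf, by simp⟩
  | succ k ih =>
    obtain ⟨C, hBC, hC, hCf, hk⟩ := ih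
    by_cases hfu : f u ≤ rep C u
    · exact ⟨C, hBC, hC, hCf, (min_le_left _ _).trans hfu⟩
    · obtain ⟨E, hCE, hE, hEf, hEu⟩ :=
        exists_superset_rep_eq_add_one hG hf hC hCf (not_le.1 hfu)
      refine ⟨E, hBC.trans hCE, hE, hEf, (min_le_right _ _).trans ?_⟩
      have hkC : (k : ℕ∞) ≤ rep C u := (min_le_iff.1 hk).resolve_left hfu
      rw [hEu]
      push_cast
      gcongr

theorem stmt3 {G : Type*} [AddCommGroup G] [Countable G] [Infinite G]
    (hG : (Set.range fun g : G => (12 : ℕ) • g).Infinite)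
    (f : G → ℕ∞) (hf : (f ⁻¹' {0}).Finite) :
    ∃ B : Set G, (∀ x : G, rep B x = f x) ∧
      {x : G | ¬ 1 ≤ rep B x}.Finite := by
  suffices h : ∃ B : Set G, ∀ x : G, rep B x = f x by
    obtain ⟨B, hB⟩ := h
    refine ⟨B, hB, hf.subset fun x hx => ?_⟩
    simpa [hB, Order.one_le_iff_pos] using hx
  let P := {B : Set G // B.Finite ∧ ∀ x, rep B x ≤ f x}
  let start : P := ⟨∅, Set.finite_empty, fun x => by simp [rep]⟩
  let D : G × ℕ → Order.Cofinal P := fun i =>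
    { carrier := {B | min (f i.1) i.2 ≤ rep B.1 i.1}
      isCofinal := fun B => by
        obtain ⟨C, hBC, hC, hCf, hk⟩ :=
          exists_superset_min_le_rep hG hf B.2.1 B.2.2 i.1 i.2
        exact ⟨⟨C, hC, hCf⟩, hk, hBC⟩ }
  have := Encodable.ofCountable (G × ℕ)
  let I := Order.idealOfCofinals start D
  let 𝓑 : Set (Set G) := Subtype.val '' (I : Set P)
  have hne : 𝓑.Nonempty := I.nonempty.image _
  have hdir : DirectedOn (· ⊆ ·) 𝓑 := by
    rintro _ ⟨B, hB, rfl⟩ _ ⟨C, hC, rfl⟩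
    obtain ⟨E, hE, hBE, hCE⟩ := I.directed B hB C hC
    exact ⟨E.1, ⟨E, hE, rfl⟩, hBE, hCE⟩
  refine ⟨⋃₀ 𝓑, fun x => le_antisymm (rep_sUnion_le hne hdir ?_) ?_⟩
  · rintro _ ⟨B, -, rfl⟩
    exact B.2.2 x
  · have hmin : ∀ k : ℕ, min (f x) k ≤ rep (⋃₀ 𝓑) x := fun k => by
      obtain ⟨B, hBD, hBI⟩ := Order.cofinal_meets_idealOfCofinals start D (x, k)
      have hB : B.1 ∈ 𝓑 := ⟨B, hBI, rfl⟩
      exact le_trans hBD (rep_mono (Set.subset_sUnion_of_mem hB) x)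
    refine ENat.forall_natCast_le_iff_le.1 fun k hk => ?_
    simpa [min_eq_right hk] using hmin k
end
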